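/- Let T₁ = span(e₁ + i·e₂) and T₂ = span(e₅ + i·e₆, e₇ + i·e₈), where i is the imaginary unit. Then there do not exist subspaces C₁ ⊆ C₂ of V and linear automorphisms g, g' of V, each preserving B (B(g x, g y) = B(x, y) and B(g' x, g' y) = B(x, y) for all x, y) and each mapping U onto U and W onto W, such that g(T₁) = C₁ and g'(T₂) = C₂. -/

import Mathlib

open Module

namespace Stmt19

/-- `V = ℂ⁸`. -/
abbrev V : Type := Fin 8 → ℂ

/-- The standard symmetric bilinear form `B x y = ∑ j, x j * y j` on `ℂ⁸`. -/
noncomputable def B (x y : V) : ℂ := ∑ j : Fin 8, x j * y j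

/-- The standard basis vectors of `ℂ⁸` (indexed from `0` to `7`). -/
noncomputable def e (j : Fin 8) : V := Pi.single j 1

/-- `U = span(e₁, e₂, e₃, e₄)`. -/
noncomputable def U : Submodule ℂ V := Submodule.span ℂ {e 0, e 1, e 2, e 3}

/-- `W = span(e₅, e₆, e₇, e₈)`. -/
noncomputable def W : Submodule ℂ V := Submodule.span ℂ {e 4, e 5, e 6, e 7}

/-- `T₁ = span(e₁ + i e₂)`. -/
noncomputable def T₁ : Submodule ℂ V := Submodule.span ℂ {e 0 + Complex.I • e 1}

/-- `T₂ = span(e₅ + i e₆, e₇ + i e₈)`. -/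
noncomputable def T₂ : Submodule ℂ V :=
  Submodule.span ℂ {e 4 + Complex.I • e 5, e 6 + Complex.I • e 7}

theorem T₁_le_U : T₁ ≤ U := by
  refine Submodule.span_le.2 (Set.singleton_subset_iff.2 ?_)
  exact add_mem (Submodule.subset_span (by simp))
    (U.smul_mem _ (Submodule.subset_span (by simp)))

theorem T₂_le_W : T₂ ≤ W := by
  refine Submodule.span_le.2 (Set.pair_subset ?_ ?_) <;>
  exact add_mem (Submodule.subset_span (by simp))
    (W.smul_mem _ (Submodule.subset_span (by simp)))

theorem T₁_ne_bot : T₁ ≠ ⊥ := by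
  intro h
  have h0 := Submodule.span_singleton_eq_bot.1 h
  simpa [e] using congrFun h0 0

theorem span_e_disjoint {s t : Set (Fin 8)} (h : Disjoint s t) :
    Disjoint (Submodule.span ℂ (e '' s)) (Submodule.span ℂ (e '' t)) := by
  refine LinearIndependent.disjoint_span_image ?_ h
  convert (Pi.basisFun ℂ (Fin 8)).linearIndependent using 1
  ext1 j
  simp [e]

theorem disjoint_U_W : Disjoint U W := by
  have h := span_e_disjoint (s := {0, 1, 2, 3}) (t := {4, 5, 6, 7}) (by simp)
  simpa only [U, W, Set.image_insert_eq, Set.image_singleton] using h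

/-- there is no flag `C₁ ⊆ C₂` with `C₁` in the orbit of `T₁` and
`C₂` in the orbit of `T₂` under isometries preserving `U` and `W`. -/
theorem stmt_19 :
    ¬ (∃ (C₁ C₂ : Submodule ℂ V) (g g' : V ≃ₗ[ℂ] V),
      C₁ ≤ C₂ ∧
      (∀ x y : V, B (g x) (g y) = B x y) ∧
      (∀ x y : V, B (g' x) (g' y) = B x y) ∧
      Submodule.map (g : V →ₗ[ℂ] V) U = U ∧
      Submodule.map (g : V →ₗ[ℂ] V) W = W ∧
      Submodule.map (g' : V →ₗ[ℂ] V) U = U ∧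
      Submodule.map (g' : V →ₗ[ℂ] V) W = W ∧
      Submodule.map (g : V →ₗ[ℂ] V) T₁ = C₁ ∧
      Submodule.map (g' : V →ₗ[ℂ] V) T₂ = C₂) := by
  rintro ⟨C₁, C₂, g, g', hC, -, -, hU, -, -, hW, rfl, rfl⟩
  have hgU : Submodule.map (g : V →ₗ[ℂ] V) T₁ ≤ U := (Submodule.map_mono T₁_le_U).trans_eq hU
  have hgW : Submodule.map (g : V →ₗ[ℂ] V) T₁ ≤ W :=
    hC.trans ((Submodule.map_mono T₂_le_W).trans_eq hW)
  have hbot := disjoint_U_W hgU hgW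
  refine T₁_ne_bot (Submodule.map_injective_of_injective g.injective ?_)
  exact (le_bot_iff.1 hbot).trans (Submodule.map_bot _).symm

end Stmt19
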